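/- arXiv:1109.2402 — 3 statements merged into one kernel-verified Lean document; each statement's English description precedes it below -/
import Mathlib

section
/- Let k be a field and let σ, ν, μ be partitions. If there exists a short exact sequence of k[T]-modules 0 → M(ν,k) → M(σ,k) → M(μ,k) → 0, then for every m ≥ 1 one has σ₁ + σ₂ + … + σ_m ≤ λ₁ + λ₂ + … + λ_m, where λ = μ + ν is the componentwise sum of the partitions μ and ν. -/
open Polynomial

/-- A partition: a weakly decreasing sequence of natural numbers with
finitely many nonzero terms (0-indexed: `parts i` is the `(i+1)`-st part). -/
structure PartitionSeq where
  parts : ℕ → ℕ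
  antitone : ∀ ⦃i j : ℕ⦄, i ≤ j → parts j ≤ parts i
  finite_support : {i : ℕ | parts i ≠ 0}.Finite

/-- The nilpotent `k[T]`-module `M(λ, k) = ⊕ᵢ k[T]/(T^{λᵢ})`. -/
abbrev MMod (k : Type) [Field k] (lam : ℕ → ℕ) :=
  DirectSum ℕ (fun i => Polynomial k ⧸ Ideal.span {(X : Polynomial k) ^ lam i})

/-- In a finite-dimensional space, the dimension of the kernel of an endomorphism does not increase
when passing to a quotient. -/
theorem finrank_ker_le_of_surjective {k V W : Type*} [Field k] [AddCommGroup V] [Module k V]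
    [FiniteDimensional k V] [AddCommGroup W] [Module k W] (S : Module.End k V) (T : Module.End k W)
    (p : V →ₗ[k] W) (hp : Function.Surjective p) (hST : p ∘ₗ S = T ∘ₗ p) :
    Module.finrank k (LinearMap.ker T) ≤ Module.finrank k (LinearMap.ker S) := by
  have : FiniteDimensional k W := Module.Finite.of_surjective p hp
  have hle : LinearMap.range S ≤ (LinearMap.range T).comap p := by
    rintro _ ⟨v, rfl⟩
    exact ⟨p v, (LinearMap.congr_fun hST v).symm⟩
  have hsurj : Function.Surjective ((LinearMap.range S).mapQ (LinearMap.range T) p hle) := by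
    intro x
    obtain ⟨w, rfl⟩ := Submodule.mkQ_surjective _ x
    obtain ⟨v, rfl⟩ := hp w
    exact ⟨(LinearMap.range S).mkQ v, rfl⟩
  have h := LinearMap.finrank_le_finrank_of_surjective hsurj
  have h1 := Submodule.finrank_quotient_add_finrank (LinearMap.range S)
  have h2 := Submodule.finrank_quotient_add_finrank (LinearMap.range T)
  have h3 := LinearMap.finrank_range_add_finrank_ker S
  have h4 := LinearMap.finrank_range_add_finrank_ker T
  omega

theorem finrank_range_pow_eq_add {k V : Type*} [Field k] [AddCommGroup V] [Module k V]
    [FiniteDimensional k V] (T : Module.End k V) (n : ℕ) :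
    Module.finrank k (LinearMap.range (T ^ n)) = Module.finrank k (LinearMap.range (T ^ (n + 1))) +
      Module.finrank k (LinearMap.ker T ⊓ LinearMap.range (T ^ n) : Submodule k V) := by
  have h := LinearMap.finrank_range_add_finrank_ker (T.domRestrict (LinearMap.range (T ^ n)))
  rw [LinearMap.range_domRestrict, LinearMap.ker_domRestrict, ← LinearMap.range_comp,
    ← Module.End.mul_eq_comp, ← pow_succ'] at h
  rw [← h, ← Submodule.finrank_map_subtype_eq, Submodule.map_comap_subtype, inf_comm]

/-- The dimension of a space with a nilpotent endomorphism, as the number of cells of the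
associated Young diagram counted along the successive images. -/
theorem finrank_eq_sum_finrank_ker_inf_range_pow {k V : Type*} [Field k] [AddCommGroup V]
    [Module k V] [FiniteDimensional k V] (T : Module.End k V) {n : ℕ} (hT : T ^ n = 0) :
    Module.finrank k V = ∑ j ∈ Finset.range n,
      Module.finrank k (LinearMap.ker T ⊓ LinearMap.range (T ^ j) : Submodule k V) := by
  have key : ∀ n, Module.finrank k V = Module.finrank k (LinearMap.range (T ^ n)) +
      ∑ j ∈ Finset.range n,
        Module.finrank k (LinearMap.ker T ⊓ LinearMap.range (T ^ j) : Submodule k V) := by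
    intro n
    induction n with
    | zero =>
      rw [pow_zero, Module.End.one_eq_id, LinearMap.range_id, finrank_top, Finset.range_zero,
        Finset.sum_empty, add_zero]
    | succ n ih =>
      rw [ih, finrank_range_pow_eq_add, Finset.sum_range_succ]
      ring
  rw [key n, hT, LinearMap.range_zero, finrank_bot, zero_add]

theorem finrank_ker_lsmul_X_le_one (k : Type*) [Field k] (n : ℕ) :
    Module.finrank k (LinearMap.ker
      (Algebra.lsmul k k (k[X] ⧸ Ideal.span {(X : k[X]) ^ n}) (X : k[X]))) ≤ 1 := by
  have hv : (X : k[X]) • Ideal.Quotient.mk (Ideal.span {(X : k[X]) ^ n}) (X ^ (n - 1)) = 0 := by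
    rw [← Ideal.Quotient.mk_eq_mk, ← Submodule.Quotient.mk_smul, Ideal.Quotient.mk_eq_mk,
      Ideal.Quotient.eq_zero_iff_mem, Ideal.mem_span_singleton, smul_eq_mul, ← pow_succ']
    exact pow_dvd_pow _ (by omega)
  refine finrank_le_one ⟨Ideal.Quotient.mk _ (X ^ (n - 1)), hv⟩ ?_
  rintro ⟨w, hw⟩
  obtain ⟨p, rfl⟩ := Ideal.Quotient.mk_surjective w
  replace hw : (X : k[X]) • Ideal.Quotient.mk (Ideal.span {(X : k[X]) ^ n}) p = 0 := hw
  rw [← Ideal.Quotient.mk_eq_mk, ← Submodule.Quotient.mk_smul, Ideal.Quotient.mk_eq_mk,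
      Ideal.Quotient.eq_zero_iff_mem, Ideal.mem_span_singleton, smul_eq_mul] at hw
  have hdvd : (X : k[X]) ^ (n - 1) ∣ p := by
    rcases n with _ | n
    · simp
    · rw [pow_succ'] at hw
      exact (mul_dvd_mul_iff_left X_ne_zero).1 hw
  obtain ⟨q, rfl⟩ := hdvd
  refine ⟨q.coeff 0, Subtype.ext ?_⟩
  change q.coeff 0 • Ideal.Quotient.mk _ (X ^ (n - 1)) = Ideal.Quotient.mk _ (X ^ (n - 1) * q)
  rw [← Ideal.Quotient.mk_eq_mk, ← Submodule.Quotient.mk_smul, Ideal.Quotient.mk_eq_mk,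
    Ideal.Quotient.eq, Ideal.mem_span_singleton]
  have hq : q.coeff 0 • X ^ (n - 1) - X ^ (n - 1) * q = -(X ^ (n - 1) * X) * q.divX := by
    rw [smul_eq_C_mul]
    linear_combination -X ^ (n - 1) * (X_mul_divX_add q).symm
  rw [hq, neg_mul, dvd_neg, ← pow_succ]
  exact Dvd.dvd.mul_right (pow_dvd_pow _ (by omega)) _

instance finiteDimensional_quotient_span_X_pow (k : Type*) [Field k] (n : ℕ) :
    FiniteDimensional k (k[X] ⧸ Ideal.span {(X : k[X]) ^ n}) :=
  (monic_X_pow n).finite_quotient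

theorem X_pow_smul_quotient_eq_zero {k : Type*} [Field k] {n j : ℕ} (h : n ≤ j)
    (x : k[X] ⧸ Ideal.span {(X : k[X]) ^ n}) : (X : k[X]) ^ j • x = 0 := by
  obtain ⟨p, rfl⟩ := Ideal.Quotient.mk_surjective x
  rw [← Ideal.Quotient.mk_eq_mk, ← Submodule.Quotient.mk_smul, Ideal.Quotient.mk_eq_mk,
    Ideal.Quotient.eq_zero_iff_mem, Ideal.mem_span_singleton, smul_eq_mul]
  exact (pow_dvd_pow _ h).mul_right _

theorem lsmul_X_pow_apply {k V : Type*} [Field k] [AddCommGroup V] [Module k V] [Module k[X] V]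
    [IsScalarTower k k[X] V] (j : ℕ) (v : V) :
    (Algebra.lsmul k k V (X : k[X]) ^ j) v = (X : k[X]) ^ j • v := by
  rw [← map_pow, Algebra.lsmul_coe]

theorem finrank_le_card_of_le_ker_lsmul_X {k ι U : Type*} {C : ι → Type*} [Field k] [Fintype ι]
    [AddCommGroup U] [Module k U] [Module k[X] U] [IsScalarTower k k[X] U]
    [∀ i, AddCommGroup (C i)] [∀ i, Module k (C i)] [∀ i, Module k[X] (C i)]
    [∀ i, IsScalarTower k k[X] (C i)] [∀ i, FiniteDimensional k (C i)]
    (hC : ∀ i, Module.finrank k (LinearMap.ker (Algebra.lsmul k k (C i) (X : k[X]))) ≤ 1)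
    (K : Submodule k U) (hK : K ≤ LinearMap.ker (Algebra.lsmul k k U (X : k[X])))
    (χ : ∀ i, U →ₗ[k[X]] C i) (hχ : ∀ v ∈ K, (∀ i, χ i v = 0) → v = 0) :
    Module.finrank k K ≤ Fintype.card ι := by
  let ψ (i : ι) : K →ₗ[k] LinearMap.ker (Algebra.lsmul k k (C i) (X : k[X])) :=
    ((χ i).restrictScalars k ∘ₗ K.subtype).codRestrict _ fun v => by
      have hv : (X : k[X]) • (v : U) = 0 := hK v.2
      change (X : k[X]) • χ i v = 0
      rw [← map_smul, hv, map_zero]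
  have hψ : Function.Injective (LinearMap.pi ψ) :=
    (injective_iff_map_eq_zero _).2 fun v hv =>
      Subtype.ext (hχ v v.2 fun i => congrArg Subtype.val (congrFun hv i))
  calc Module.finrank k K ≤ _ := LinearMap.finrank_le_finrank_of_injective hψ
    _ ≤ ∑ _i : ι, 1 := by
      rw [Module.finrank_pi_fintype]
      exact Finset.sum_le_sum fun i _ => hC i
    _ = Fintype.card ι := by simp

/-- In a submodule of `M(λ, k)`, the socle of the `j`-th multiple has dimension at most the number
of parts of `λ` exceeding `j`. -/
theorem finrank_ker_inf_range_pow_le {k : Type} [Field k] {V : Type*} [AddCommGroup V] [Module k V]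
    [Module k[X] V] [IsScalarTower k k[X] V] (lam : PartitionSeq)
    (φ : V →ₗ[k[X]] MMod k lam.parts) (hφ : Function.Injective φ) (j : ℕ) :
    Module.finrank k (LinearMap.ker (Algebra.lsmul k k V (X : k[X])) ⊓
      LinearMap.range (Algebra.lsmul k k V (X : k[X]) ^ j) : Submodule k V) ≤
      {i | j < lam.parts i}.ncard := by
  have hfin : {i | j < lam.parts i}.Finite :=
    lam.finite_support.subset fun i (hi : j < lam.parts i) => by
      have : lam.parts i ≠ 0 := by omega
      exact this
  have := hfin.fintype
  rw [← Nat.card_coe_set_eq, Nat.card_eq_fintype_card]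
  refine finrank_le_card_of_le_ker_lsmul_X (fun i => finrank_ker_lsmul_X_le_one k _) _ inf_le_left
    (fun i : {i | j < lam.parts i} => DirectSum.component k[X] ℕ _ i ∘ₗ φ) ?_
  rintro v ⟨-, w, hw⟩ hv
  rw [lsmul_X_pow_apply] at hw
  refine hφ (DirectSum.ext_component k[X] fun i => ?_)
  rw [map_zero, map_zero]
  by_cases hi : j < lam.parts i
  · exact hv ⟨i, hi⟩
  · rw [← hw, map_smul, map_smul]
    exact X_pow_smul_quotient_eq_zero (not_lt.1 hi) _

theorem PartitionSeq.sum_min_ncard_le (lam : PartitionSeq) (m : ℕ) :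
    ∑ j ∈ Finset.range (lam.parts 0), min m {i | j < lam.parts i}.ncard ≤
      ∑ i ∈ Finset.range m, lam.parts i := by
  have hmin (j : ℕ) : min m {i | j < lam.parts i}.ncard ≤
      ∑ i ∈ Finset.range m, if j < lam.parts i then 1 else 0 := by
    rw [← Finset.card_filter]
    by_cases h : ∀ i < m, j < lam.parts i
    · rw [Finset.filter_true_of_mem fun i hi => h i (Finset.mem_range.1 hi), Finset.card_range]
      exact min_le_left _ _
    · push Not at h
      obtain ⟨a, ham, ha⟩ := h
      refine (min_le_right _ _).trans ?_
      rw [← Set.ncard_coe_finset]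
      refine Set.ncard_le_ncard (fun i (hi : j < lam.parts i) => ?_) (Finset.finite_toSet _)
      have hia : i < a := by
        by_contra! hai
        have := lam.antitone hai
        omega
      simp only [Finset.coe_filter, Finset.mem_range, Set.mem_ofPred_eq]
      exact ⟨hia.trans ham, hi⟩
  refine (Finset.sum_le_sum fun j _ => hmin j).trans ?_
  rw [Finset.sum_comm]
  refine Finset.sum_le_sum fun i _ => ?_
  rw [← Finset.card_filter]
  calc _ ≤ (Finset.range (lam.parts i)).card :=
        Finset.card_le_card fun j hj => Finset.mem_range.2 (Finset.mem_filter.1 hj).2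
    _ = _ := Finset.card_range _

/-- A submodule of `M(λ, k)` with socle of dimension at most `m` has dimension at most
`λ₁ + ⋯ + λ_m`. -/
theorem finrank_le_sum_parts_of_injective {k : Type} [Field k] {V : Type*} [AddCommGroup V]
    [Module k V] [Module k[X] V] [IsScalarTower k k[X] V] [FiniteDimensional k V]
    (lam : PartitionSeq) (φ : V →ₗ[k[X]] MMod k lam.parts) (hφ : Function.Injective φ) {m : ℕ}
    (hm : Module.finrank k (LinearMap.ker (Algebra.lsmul k k V (X : k[X]))) ≤ m) :
    Module.finrank k V ≤ ∑ i ∈ Finset.range m, lam.parts i := by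
  have hT : Algebra.lsmul k k V (X : k[X]) ^ lam.parts 0 = 0 := by
    ext v
    rw [lsmul_X_pow_apply]
    refine hφ (DirectSum.ext_component k[X] fun i => ?_)
    rw [map_smul, map_smul, LinearMap.zero_apply, map_zero, map_zero]
    exact X_pow_smul_quotient_eq_zero (lam.antitone (Nat.zero_le i)) _
  rw [finrank_eq_sum_finrank_ker_inf_range_pow _ hT]
  refine (Finset.sum_le_sum fun j _ => le_min ?_ ?_).trans (lam.sum_min_ncard_le m)
  · exact (Submodule.finrank_mono inf_le_left).trans hm
  · exact finrank_ker_inf_range_pow_le lam φ hφ j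

theorem finrank_ker_lsmul_X_pi_le (k : Type*) [Field k] {m : ℕ} (a : Fin m → ℕ) :
    Module.finrank k (LinearMap.ker (Algebra.lsmul k k
      (∀ i, k[X] ⧸ Ideal.span {(X : k[X]) ^ a i}) (X : k[X]))) ≤ m := by
  simpa using finrank_le_card_of_le_ker_lsmul_X
    (fun i : Fin m => finrank_ker_lsmul_X_le_one k (a i)) _ le_rfl
    (fun i => LinearMap.proj i) fun v _ hv => funext hv

theorem finrank_pi_quotient_span_X_pow (k : Type*) [Field k] {m : ℕ} (a : Fin m → ℕ) :
    Module.finrank k (∀ i, k[X] ⧸ Ideal.span {(X : k[X]) ^ a i}) = ∑ i, a i := by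
  rw [Module.finrank_pi_fintype]
  refine Finset.sum_congr rfl fun i _ => ?_
  rw [finrank_quotient_span_eq_natDegree, natDegree_X_pow]

/-- The direct sum of the first `m` summands of `M(λ, k)` embeds into `M(λ, k)`. -/
theorem exists_injective_pi_to_MMod (k : Type) [Field k] (lam : ℕ → ℕ) (m : ℕ) :
    ∃ ι : (∀ i : Fin m, k[X] ⧸ Ideal.span {(X : k[X]) ^ lam i}) →ₗ[k[X]] MMod k lam,
      Function.Injective ι := by
  let M (i : ℕ) := k[X] ⧸ Ideal.span {(X : k[X]) ^ lam i}
  refine ⟨∑ i : Fin m, DirectSum.lof k[X] ℕ M i ∘ₗ LinearMap.proj i, fun v w hvw => ?_⟩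
  funext j
  have hcomp (u : ∀ i : Fin m, M i) : DirectSum.component k[X] ℕ M j
      ((∑ i : Fin m, DirectSum.lof k[X] ℕ M i ∘ₗ LinearMap.proj i) u) = u j := by
    rw [LinearMap.sum_apply, map_sum, Finset.sum_eq_single j]
    · exact DirectSum.component.lof_self k[X] (j : ℕ) (u j)
    · intro i _ hij
      exact DirectSum.of_eq_of_ne _ _ _ fun h => hij (Fin.ext h.symm)
    · simp
  rw [← hcomp v, ← hcomp w]
  exact congrArg _ hvw

theorem finrank_ker_lsmul_X_submodule_le {k V : Type*} [Field k] [AddCommGroup V] [Module k V]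
    [Module k[X] V] [IsScalarTower k k[X] V] [FiniteDimensional k V] (N : Submodule k[X] V) :
    Module.finrank k (LinearMap.ker (Algebra.lsmul k k N (X : k[X]))) ≤
      Module.finrank k (LinearMap.ker (Algebra.lsmul k k V (X : k[X]))) := by
  let ψ : LinearMap.ker (Algebra.lsmul k k N (X : k[X])) →ₗ[k]
      LinearMap.ker (Algebra.lsmul k k V (X : k[X])) :=
    (N.subtype.restrictScalars k ∘ₗ Submodule.subtype _).codRestrict _ fun v =>
      congrArg Subtype.val v.2
  exact LinearMap.finrank_le_finrank_of_injective (f := ψ) fun v w hvw => by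
    have h := congrArg Subtype.val hvw
    exact Subtype.ext (Subtype.ext h)

theorem exists_injective_quotient_ker {R V M : Type*} [Ring R] [AddCommGroup V] [Module R V]
    [AddCommMonoid M] [Module R M] (h : V →ₗ[R] M) :
    ∃ q : (V ⧸ LinearMap.ker h) →ₗ[R] M, Function.Injective q := by
  let _ : AddCommGroup M := Module.addCommMonoidToAddCommGroup R
  exact ⟨(LinearMap.ker h).liftQ h le_rfl,
    LinearMap.ker_eq_bot.1 (Submodule.ker_liftQ_eq_bot _ _ _ le_rfl)⟩

/-- If `V` embeds into an extension of `M(μ, k)` by `M(ν, k)` and has socle of dimension at most `m`,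
then its dimension is at most the sum of the first `m` parts of `μ + ν`. -/
theorem finrank_le_sum_parts_add_parts {k : Type} [Field k] {V E : Type*} [AddCommGroup V]
    [Module k V] [Module k[X] V] [IsScalarTower k k[X] V] [FiniteDimensional k V]
    [AddCommMonoid E] [Module k[X] E] (ν μ : PartitionSeq) (f : MMod k ν.parts →ₗ[k[X]] E)
    (g : E →ₗ[k[X]] MMod k μ.parts) (hf : Function.Injective f)
    (hfg : LinearMap.range f = LinearMap.ker g) (ι : V →ₗ[k[X]] E) (hι : Function.Injective ι)
    {m : ℕ} (hm : Module.finrank k (LinearMap.ker (Algebra.lsmul k k V (X : k[X]))) ≤ m) :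
    Module.finrank k V ≤ ∑ i ∈ Finset.range m, (μ.parts i + ν.parts i) := by
  let h := g ∘ₗ ι
  let N := LinearMap.ker h
  have hN : FiniteDimensional k N := FiniteDimensional.finiteDimensional_submodule
    (N.restrictScalars k)
  have hQ : FiniteDimensional k (V ⧸ N) :=
    Module.Finite.of_surjective (N.mkQ.restrictScalars k) N.mkQ_surjective
  have hsum : Module.finrank k (V ⧸ N) + Module.finrank k N = Module.finrank k V :=
    Submodule.finrank_quotient_add_finrank (N.restrictScalars k)
  let e := LinearEquiv.ofInjective f hf
  let ιN : N →ₗ[k[X]] LinearMap.range f :=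
    (ι ∘ₗ N.subtype).codRestrict _ fun v => by
      rw [hfg]
      exact v.2
  have hιN : Function.Injective ιN := fun v w hvw =>
    Subtype.ext (hι (congrArg Subtype.val hvw))
  have hkerQ : Module.finrank k (LinearMap.ker (Algebra.lsmul k k (V ⧸ N) (X : k[X]))) ≤
      Module.finrank k (LinearMap.ker (Algebra.lsmul k k V (X : k[X]))) :=
    finrank_ker_le_of_surjective _ _ (N.mkQ.restrictScalars k) N.mkQ_surjective
      (LinearMap.ext fun _ => rfl)
  have hle := finrank_le_sum_parts_of_injective ν (e.symm.toLinearMap ∘ₗ ιN)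
    (e.symm.injective.comp hιN) ((finrank_ker_lsmul_X_submodule_le N).trans hm)
  obtain ⟨q, hq⟩ := exists_injective_quotient_ker h
  have hle' := finrank_le_sum_parts_of_injective μ q hq (hkerQ.trans hm)
  rw [Finset.sum_add_distrib, ← hsum]
  exact add_le_add hle' hle

theorem sum_parts_le_of_shortExact (k : Type) [Field k] (σ ν μ : PartitionSeq)
    (h : ∃ (f : MMod k ν.parts →ₗ[Polynomial k] MMod k σ.parts)
           (g : MMod k σ.parts →ₗ[Polynomial k] MMod k μ.parts),
           Function.Injective f ∧ Function.Surjective g ∧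
           LinearMap.range f = LinearMap.ker g) :
    ∀ m : ℕ, 1 ≤ m →
      ∑ i ∈ Finset.range m, σ.parts i
        ≤ ∑ i ∈ Finset.range m, (μ.parts i + ν.parts i) := by
  obtain ⟨f, g, hf, -, hfg⟩ := h
  intro m _
  obtain ⟨ι, hι⟩ := exists_injective_pi_to_MMod k σ.parts m
  have hker := finrank_ker_lsmul_X_pi_le k fun i : Fin m => σ.parts i
  have hdim := finrank_pi_quotient_span_X_pow k fun i : Fin m => σ.parts i
  rw [Fin.sum_univ_eq_sum_range σ.parts] at hdim
  rw [← hdim]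
  exact finrank_le_sum_parts_add_parts ν μ f g hf hfg ι hι hker
end

section
/- Let k be a field and let σ, ν, μ be partitions. If there exists a short exact sequence of k[T]-modules 0 → M(ν,k) → M(σ,k) → M(μ,k) → 0, then for every m ≥ 1 one has λ̄₁ + λ̄₂ + … + λ̄_m ≤ σ̄₁ + σ̄₂ + … + σ̄_m, where λ = μ + ν is the componentwise sum of the partitions μ and ν and λ̄ denotes the dual (conjugate) partition of λ. -/
open Polynomial

/-- The `i`-th part of the dual (conjugate) partition (1-indexed in `i`):
`λ̄ᵢ = #{j : λⱼ ≥ i}`. -/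
noncomputable def dualPart (lam : ℕ → ℕ) (i : ℕ) : ℕ :=
  {j : ℕ | i ≤ lam j}.ncard

section CyclicLength

variable {R : Type*} [CommRing R] {p : R}

lemma length_quotient_span_pow_of_isMaximal [IsDomain R] (hp : p ≠ 0)
    (hmax : (Ideal.span {p}).IsMaximal) (a : ℕ) : Module.length R (R ⧸ Ideal.span {p ^ a}) = a := by
  have h := Ring.ord_pow (mem_nonZeroDivisors_of_ne_zero hp) a
  have hs : IsSimpleModule R (R ⧸ Ideal.span {p}) :=
    isSimpleModule_iff_isCoatom.mpr (Ideal.isMaximal_def.mp hmax)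
  have h1 : Ring.ord R p = 1 := Module.length_eq_one R (R ⧸ Ideal.span {p})
  rw [h1] at h
  simpa [Ring.ord] using h

lemma length_pi_quotient_span_pow [IsDomain R] (hp : p ≠ 0) (hmax : (Ideal.span {p}).IsMaximal)
    (lam : ℕ → ℕ) (n : ℕ) :
    Module.length R (Π i : Fin n, R ⧸ Ideal.span {p ^ lam i}) =
      ((∑ i ∈ Finset.range n, lam i : ℕ) : ℕ∞) := by
  rw [Module.length_pi_of_fintype]
  simp only [length_quotient_span_pow_of_isMaximal hp hmax]
  rw [Fin.sum_univ_eq_sum_range (fun i => (lam i : ℕ∞)) n]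
  push_cast
  rfl

/-- A module with `r` generators modulo `q` has length at most `r` times that of `R ⧸ (q)`. -/
lemma length_quotient_range_lsmul_le {P : Type*} [AddCommGroup P] [Module R P] {r : ℕ}
    (φ : (Fin r → R) →ₗ[R] P) (hφ : Function.Surjective φ) (q : R) :
    Module.length R (P ⧸ LinearMap.range (LinearMap.lsmul R P q)) ≤
      Module.length R (Fin r → R ⧸ Ideal.span {q}) := by
  set t := LinearMap.range (LinearMap.lsmul R P q)
  have hker (i : Fin r) : Ideal.span {q} ≤
      LinearMap.ker (LinearMap.toSpanSingleton R (P ⧸ t) (t.mkQ (φ (Pi.single i 1)))) := by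
    rw [Ideal.span_singleton_le_iff_mem, LinearMap.mem_ker, LinearMap.toSpanSingleton_apply,
      ← map_smul]
    exact (Submodule.Quotient.mk_eq_zero t).mpr ⟨_, rfl⟩
  let F : (Fin r → R ⧸ Ideal.span {q}) →ₗ[R] P ⧸ t :=
    LinearMap.lsum R (fun _ => R ⧸ Ideal.span {q}) ℕ fun i => Submodule.liftQ _ _ (hker i)
  refine Module.length_le_of_surjective F fun y => ?_
  obtain ⟨x, rfl⟩ := t.mkQ_surjective y
  obtain ⟨v, rfl⟩ := hφ x
  refine ⟨fun i => Submodule.Quotient.mk (v i), ?_⟩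
  simp only [F, LinearMap.lsum_apply, LinearMap.sum_apply, LinearMap.comp_apply,
    LinearMap.proj_apply, Submodule.liftQ_apply, LinearMap.toSpanSingleton_apply, ← map_smul,
    ← map_sum]
  congr 2
  conv_rhs => rw [← Finset.univ_sum_single v]
  refine Finset.sum_congr rfl fun i _ => ?_
  rw [← Pi.single_smul', smul_eq_mul, mul_one]

/-- The image of multiplication by `p ^ a` on `⨁ R ⧸ (p ^ lam i)` has length at most that of
`⨁ R ⧸ (p ^ (lam i - a))`. -/
lemma length_range_lsmul_pow_le {P : Type*} [AddCommGroup P] [Module R P] {n : ℕ} (lam : ℕ → ℕ)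
    (ψ : P →ₗ[R] Π i : Fin n, R ⧸ Ideal.span {p ^ lam i}) (hψ : Function.Injective ψ) (a : ℕ) :
    Module.length R (LinearMap.range (LinearMap.lsmul R P (p ^ a))) ≤
      Module.length R (Π i : Fin n, R ⧸ Ideal.span {p ^ (lam i - a)}) := by
  have hle (i : Fin n) : Ideal.span {p ^ (lam i - a)} ≤
      Submodule.comap (LinearMap.lsmul R R (p ^ a)) (Ideal.span {p ^ lam i}) := by
    rw [Ideal.span_singleton_le_iff_mem, Submodule.mem_comap, LinearMap.lsmul_apply, smul_eq_mul,
      ← pow_add, Ideal.mem_span_singleton]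
    exact pow_dvd_pow p (by omega)
  let c : (Π i : Fin n, R ⧸ Ideal.span {p ^ (lam i - a)}) →ₗ[R]
      Π i : Fin n, R ⧸ Ideal.span {p ^ lam i} :=
    LinearMap.pi fun i => (Submodule.mapQ _ _ _ (hle i)).comp (LinearMap.proj i)
  have hc (x : LinearMap.range (LinearMap.lsmul R P (p ^ a))) :
      ψ.comp (Submodule.subtype _) x ∈ LinearMap.range c := by
    obtain ⟨_, x, rfl⟩ := x
    choose v hv using fun i => Submodule.mkQ_surjective _ (ψ x i)
    refine ⟨fun i => Submodule.Quotient.mk (v i), funext fun i => ?_⟩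
    simp only [c, LinearMap.pi_apply, LinearMap.comp_apply, LinearMap.proj_apply,
      Submodule.subtype_apply, LinearMap.lsmul_apply, map_smul, Pi.smul_apply, ← hv]
    rfl
  calc _ ≤ Module.length R (LinearMap.range c) :=
        Module.length_le_of_injective (LinearMap.codRestrict _ _ hc) <|
          (LinearMap.injective_codRestrict_iff _).mpr <| hψ.comp (Submodule.subtype_injective _)
    _ ≤ _ := Module.length_le_of_surjective _ c.surjective_rangeRestrict

/-- A submodule with `r` generators of `⨁ R ⧸ (p ^ lam i)`, where `lam` is weakly decreasing, has
length at most the sum of the `r` largest parts of `lam`. -/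
lemma length_le_sum_of_surjective_of_injective [IsDomain R] (hp : p ≠ 0)
    (hmax : (Ideal.span {p}).IsMaximal)
    {P : Type*} [AddCommGroup P] [Module R P] {r n : ℕ} {lam : ℕ → ℕ} (hlam : Antitone lam)
    (φ : (Fin r → R) →ₗ[R] P) (hφ : Function.Surjective φ)
    (ψ : P →ₗ[R] Π i : Fin n, R ⧸ Ideal.span {p ^ lam i}) (hψ : Function.Injective ψ) :
    Module.length R P ≤ ((∑ i ∈ Finset.range r, lam i : ℕ) : ℕ∞) := by
  set a := lam r
  set t := LinearMap.range (LinearMap.lsmul R P (p ^ a))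
  have h1 : Module.length R P = Module.length R t + Module.length R (P ⧸ t) :=
    Module.length_eq_add_of_exact t.subtype t.mkQ t.subtype_injective t.mkQ_surjective
      (LinearMap.exact_subtype_mkQ t)
  have h2 := length_range_lsmul_pow_le lam ψ hψ a
  have h3 := length_quotient_range_lsmul_le φ hφ (p ^ a)
  rw [length_pi_quotient_span_pow hp hmax (fun i => lam i - a)] at h2
  rw [length_pi_quotient_span_pow hp hmax (fun _ => a)] at h3
  rw [h1]
  refine (add_le_add h2 h3).trans ?_
  norm_cast
  have h4 : ∑ i ∈ Finset.range n, (lam i - a) ≤ ∑ i ∈ Finset.range r, (lam i - a) := by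
    refine Finset.sum_le_sum_of_ne_zero fun i _ hi => ?_
    rw [Finset.mem_range]
    by_contra hri
    have := hlam (not_lt.mp hri)
    omega
  refine (Nat.add_le_add_right h4 _).trans ?_
  rw [← Finset.sum_add_distrib]
  refine Finset.sum_le_sum fun i hi => ?_
  have := hlam (Finset.mem_range.mp hi).le
  omega

end CyclicLength

/-- Over a PID, a submodule of a module with `r` generators has at most `r` generators. -/
lemma exists_surjective_of_injective_of_surjective {R : Type*} [CommRing R] [IsDomain R]
    [IsPrincipalIdealRing R] {P Q : Type*} [AddCommGroup P] [Module R P] [AddCommGroup Q]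
    [Module R Q] {r : ℕ} (φ : (Fin r → R) →ₗ[R] P) (hφ : Function.Surjective φ)
    (ι : Q →ₗ[R] P) (hι : Function.Injective ι) :
    ∃ s ≤ r, ∃ φ' : (Fin s → R) →ₗ[R] Q, Function.Surjective φ' := by
  let N := (LinearMap.range ι).comap φ
  obtain ⟨s, b⟩ := Submodule.basisOfPid (Pi.basisFun R (Fin r)) N
  have hs : s ≤ r := by
    have := Submodule.finrank_le N
    rwa [Module.finrank_eq_card_basis b, Module.finrank_fin_fun, Fintype.card_fin] at this
  let e := LinearEquiv.ofInjective ι hι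
  let φN : N →ₗ[R] LinearMap.range ι := φ.restrict fun _ hx => hx
  have hφN : Function.Surjective φN := by
    rintro ⟨y, hy⟩
    obtain ⟨x, rfl⟩ := hφ y
    exact ⟨⟨x, hy⟩, rfl⟩
  exact ⟨s, hs, e.symm.toLinearMap ∘ₗ φN ∘ₗ b.equivFun.symm.toLinearMap,
    e.symm.surjective.comp (hφN.comp b.equivFun.symm.surjective)⟩

/-- If `A → B → C` is exact with `A → B` injective and `A`, `C` embed into torsion modules with
elementary divisor exponents `ν`, `μ`, then a submodule of `B` with `r` generators has length at
most the sum of the `r` largest parts of `μ + ν`. -/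
lemma length_le_sum_add_of_exact {R : Type*} [CommRing R] [IsDomain R] [IsPrincipalIdealRing R]
    {p : R} (hp : p ≠ 0) (hmax : (Ideal.span {p}).IsMaximal)
    {L A B C : Type*} [AddCommGroup L] [Module R L] [AddCommGroup A] [Module R A]
    [AddCommGroup B] [Module R B] [AddCommGroup C] [Module R C]
    {f : A →ₗ[R] B} {g : B →ₗ[R] C} (hf : Function.Injective f) (hfg : Function.Exact f g)
    {ν μ : ℕ → ℕ} (hν : Antitone ν) (hμ : Antitone μ) {n r : ℕ}
    (α : A →ₗ[R] Π i : Fin n, R ⧸ Ideal.span {p ^ ν i}) (hα : Function.Injective α)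
    (β : C →ₗ[R] Π i : Fin n, R ⧸ Ideal.span {p ^ μ i}) (hβ : Function.Injective β)
    (φ : (Fin r → R) →ₗ[R] L) (hφ : Function.Surjective φ)
    (ι : L →ₗ[R] B) (hι : Function.Injective ι) :
    Module.length R L ≤ ((∑ i ∈ Finset.range r, (μ i + ν i) : ℕ) : ℕ∞) := by
  let γ : L →ₗ[R] C := g ∘ₗ ι
  have hL : Module.length R L =
      Module.length R (LinearMap.ker γ) + Module.length R (LinearMap.range γ) :=
    Module.length_eq_add_of_exact (LinearMap.ker γ).subtype γ.rangeRestrict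
      (Submodule.subtype_injective _) γ.surjective_rangeRestrict
      (LinearMap.exact_iff.mpr (by rw [LinearMap.ker_rangeRestrict, Submodule.range_subtype]))
  have hrange := length_le_sum_of_surjective_of_injective hp hmax hμ (γ.rangeRestrict ∘ₗ φ)
    (γ.surjective_rangeRestrict.comp hφ) (β ∘ₗ (LinearMap.range γ).subtype)
    (hβ.comp (Submodule.subtype_injective _))
  obtain ⟨s, hs, φ', hφ'⟩ := exists_surjective_of_injective_of_surjective φ hφ
    (LinearMap.ker γ).subtype (Submodule.subtype_injective _)
  have hmem (x : LinearMap.ker γ) :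
      (ι ∘ₗ (LinearMap.ker γ).subtype) x ∈ LinearMap.range f :=
    (hfg _).mp x.2
  have hker := length_le_sum_of_surjective_of_injective hp hmax hν φ' hφ'
    (α ∘ₗ (LinearEquiv.ofInjective f hf).symm.toLinearMap ∘ₗ LinearMap.codRestrict _ _ hmem)
    (hα.comp <| (LinearEquiv.ofInjective f hf).symm.injective.comp <|
      (LinearMap.injective_codRestrict_iff _).mpr <| hι.comp (Submodule.subtype_injective _))
  refine (hL.le.trans (add_le_add hker hrange)).trans ?_
  norm_cast
  have := Finset.sum_le_sum_of_subset (f := ν) (Finset.range_subset_range.mpr hs)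
  rw [Finset.sum_add_distrib]
  omega

section MMod

variable {k : Type} [Field k]

lemma isMaximal_span_X : (Ideal.span {(X : k[X])}).IsMaximal :=
  PrincipalIdealRing.isMaximal_of_irreducible irreducible_X

/-- The inclusion of the first `n` summands of `MMod k lam`. -/
noncomputable def MMod.ofFin (k : Type) [Field k] (lam : ℕ → ℕ) (n : ℕ) :
    (Π i : Fin n, k[X] ⧸ Ideal.span {(X : k[X]) ^ lam i}) →ₗ[k[X]] MMod k lam :=
  LinearMap.lsum k[X] (fun i : Fin n => k[X] ⧸ Ideal.span {(X : k[X]) ^ lam i}) ℕ fun i =>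
    DirectSum.lof k[X] ℕ (fun i => k[X] ⧸ Ideal.span {(X : k[X]) ^ lam i}) i

/-- The projection of `MMod k lam` to its first `n` summands. -/
noncomputable def MMod.toFin (k : Type) [Field k] (lam : ℕ → ℕ) (n : ℕ) :
    MMod k lam →ₗ[k[X]] Π i : Fin n, k[X] ⧸ Ideal.span {(X : k[X]) ^ lam i} :=
  LinearMap.pi fun i => DirectSum.component k[X] ℕ _ i

lemma MMod.toFin_ofFin (lam : ℕ → ℕ) (n : ℕ)
    (x : Π i : Fin n, k[X] ⧸ Ideal.span {(X : k[X]) ^ lam i}) :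
    MMod.toFin k lam n (MMod.ofFin k lam n x) = x := by
  ext i
  simp only [toFin, ofFin, LinearMap.pi_apply, LinearMap.lsum_apply, LinearMap.sum_apply, map_sum,
    LinearMap.comp_apply, LinearMap.proj_apply]
  rw [Finset.sum_eq_single i]
  · exact DirectSum.component.lof_self _ _ _
  · intro j _ hj
    rw [DirectSum.component.of, dif_neg]
    exact fun h => hj (Fin.ext h)
  · simp

lemma MMod.ofFin_injective (lam : ℕ → ℕ) (n : ℕ) : Function.Injective (MMod.ofFin k lam n) :=
  Function.LeftInverse.injective (MMod.toFin_ofFin lam n)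

lemma MMod.toFin_injective {lam : ℕ → ℕ} {n : ℕ} (h : ∀ i, n ≤ i → lam i = 0) :
    Function.Injective (MMod.toFin k lam n) := by
  intro x y hxy
  refine DirectSum.ext_component k[X] fun i => ?_
  by_cases hi : i < n
  · exact congrFun hxy ⟨i, hi⟩
  · have : Subsingleton (k[X] ⧸ Ideal.span {(X : k[X]) ^ lam i}) := by
      rw [h i (not_lt.mp hi), pow_zero, Ideal.span_singleton_one]
      exact Submodule.Quotient.subsingleton_iff.mpr rfl
    exact Subsingleton.elim _ _

lemma MMod.length_eq_sum {lam : ℕ → ℕ} {n : ℕ} (h : ∀ i, n ≤ i → lam i = 0) :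
    Module.length k[X] (MMod k lam) = ((∑ i ∈ Finset.range n, lam i : ℕ) : ℕ∞) := by
  rw [← length_pi_quotient_span_pow (p := (X : k[X])) X_ne_zero isMaximal_span_X lam n]
  exact le_antisymm (Module.length_le_of_injective _ (MMod.toFin_injective h))
    (Module.length_le_of_injective _ (MMod.ofFin_injective lam n))

/-- In a short exact sequence `0 → M(ν) → M(σ) → M(μ) → 0`, the partition `σ` is dominated by
`μ + ν`. -/
lemma sum_parts_le_of_exact {σ ν μ : ℕ → ℕ} (hν : Antitone ν) (hμ : Antitone μ) {n : ℕ}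
    (hν0 : ∀ i, n ≤ i → ν i = 0) (hμ0 : ∀ i, n ≤ i → μ i = 0)
    {f : MMod k ν →ₗ[k[X]] MMod k σ} {g : MMod k σ →ₗ[k[X]] MMod k μ}
    (hf : Function.Injective f) (hfg : Function.Exact f g) (r : ℕ) :
    ∑ i ∈ Finset.range r, σ i ≤ ∑ i ∈ Finset.range r, (μ i + ν i) := by
  let φ : (Fin r → k[X]) →ₗ[k[X]] Π i : Fin r, k[X] ⧸ Ideal.span {(X : k[X]) ^ σ i} :=
    LinearMap.pi fun i => (Submodule.mkQ _).comp (LinearMap.proj i)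
  have hφ : Function.Surjective φ := fun y => by
    choose v hv using fun i => Submodule.mkQ_surjective _ (y i)
    exact ⟨v, funext hv⟩
  have h := length_le_sum_add_of_exact (R := k[X]) (p := X) (A := MMod k ν) (B := MMod k σ)
    (C := MMod k μ) X_ne_zero isMaximal_span_X hf hfg hν hμ
    (MMod.toFin k ν n) (MMod.toFin_injective hν0) (MMod.toFin k μ n) (MMod.toFin_injective hμ0)
    φ hφ (MMod.ofFin k σ r) (MMod.ofFin_injective σ r)
  rw [length_pi_quotient_span_pow (p := (X : k[X])) X_ne_zero isMaximal_span_X] at h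
  exact_mod_cast h

end MMod

lemma PartitionSeq.exists_forall_parts_eq_zero (lam : PartitionSeq) :
    ∃ n, ∀ i, n ≤ i → lam.parts i = 0 := by
  obtain ⟨b, hb⟩ := lam.finite_support.bddAbove
  refine ⟨b + 1, fun i hi => ?_⟩
  by_contra h
  have := hb h
  omega

lemma sum_dualPart_eq_sum_min {lam : ℕ → ℕ} {n : ℕ} (h : ∀ i, n ≤ i → lam i = 0) (m : ℕ) :
    ∑ i ∈ Finset.range m, dualPart lam (i + 1) = ∑ j ∈ Finset.range n, min (lam j) m := by
  have hdual (i : ℕ) :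
      dualPart lam (i + 1) = ∑ j ∈ Finset.range n, if i + 1 ≤ lam j then 1 else 0 := by
    rw [dualPart, ← Finset.card_filter, ← Set.ncard_coe_finset]
    congr 1
    ext j
    simp only [Set.mem_ofPred_eq, Finset.coe_filter, Finset.mem_range]
    refine ⟨fun hj => ⟨?_, hj⟩, fun hj => hj.2⟩
    by_contra hn
    have := h j (not_lt.mp hn)
    omega
  simp only [hdual]
  rw [Finset.sum_comm]
  refine Finset.sum_congr rfl fun j _ => ?_
  rw [← Finset.card_filter, ← Finset.card_range (min (lam j) m)]
  congr 1
  ext i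
  simp only [Finset.mem_filter, Finset.mem_range]
  omega

/-- If `σ` is dominated by `lam`, then truncating the parts at `m` reverses the inequality. -/
lemma sum_min_le_sum_min_of_dominated {σ lam : ℕ → ℕ} (hσ : Antitone σ) {n : ℕ}
    (hσ0 : ∀ i, n ≤ i → σ i = 0)
    (hle : ∀ r, ∑ i ∈ Finset.range r, σ i ≤ ∑ i ∈ Finset.range r, lam i)
    (heq : ∑ i ∈ Finset.range n, σ i = ∑ i ∈ Finset.range n, lam i) (m : ℕ) :
    ∑ i ∈ Finset.range n, min (lam i) m ≤ ∑ i ∈ Finset.range n, min (σ i) m := by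
  have hsplit (τ : ℕ → ℕ) (s : ℕ) : ∑ i ∈ Finset.range s, min (τ i) m +
      ∑ i ∈ Finset.range s, (τ i - m) = ∑ i ∈ Finset.range s, τ i := by
    rw [← Finset.sum_add_distrib]
    exact Finset.sum_congr rfl fun i _ => by omega
  have hex : ∃ r, σ r ≤ m := ⟨n, by simp [hσ0 n le_rfl]⟩
  obtain ⟨r, hr, hrmin⟩ : ∃ r, σ r ≤ m ∧ ∀ i < r, m < σ i :=
    ⟨Nat.find hex, Nat.find_spec hex, fun i hi => not_le.mp (Nat.find_min hex hi)⟩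
  have hrn : r ≤ n := by
    by_contra h
    have := hrmin n (by omega)
    rw [hσ0 n le_rfl] at this
    omega
  have h1 : ∑ i ∈ Finset.range n, (σ i - m) = ∑ i ∈ Finset.range r, (σ i - m) := by
    refine (Finset.sum_subset (Finset.range_subset_range.mpr hrn) fun i _ hi => ?_).symm
    have := hσ (not_lt.mp (mt Finset.mem_range.mpr hi))
    omega
  have h2 : ∑ i ∈ Finset.range r, (lam i - m) ≤ ∑ i ∈ Finset.range n, (lam i - m) :=
    Finset.sum_le_sum_of_subset (Finset.range_subset_range.mpr hrn)
  have h3 : ∑ i ∈ Finset.range r, min (lam i) m ≤ ∑ i ∈ Finset.range r, min (σ i) m := by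
    refine Finset.sum_le_sum fun i hi => ?_
    have := hrmin i (Finset.mem_range.mp hi)
    omega
  have := hsplit σ n
  have := hsplit lam n
  have := hsplit σ r
  have := hsplit lam r
  have := hle r
  omega

theorem sum_dualParts_le_of_shortExact (k : Type) [Field k] (σ ν μ : PartitionSeq)
    (h : ∃ (f : MMod k ν.parts →ₗ[Polynomial k] MMod k σ.parts)
           (g : MMod k σ.parts →ₗ[Polynomial k] MMod k μ.parts),
           Function.Injective f ∧ Function.Surjective g ∧
           LinearMap.range f = LinearMap.ker g) :
    ∀ m : ℕ, 1 ≤ m →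
      ∑ i ∈ Finset.range m, dualPart (fun j => μ.parts j + ν.parts j) (i + 1)
        ≤ ∑ i ∈ Finset.range m, dualPart σ.parts (i + 1) := by
  obtain ⟨f, g, hf, hg, hrange⟩ := h
  have hfg : Function.Exact f g := fun y => by
    rw [← LinearMap.mem_ker, ← hrange]
    exact LinearMap.mem_range
  intro m _
  obtain ⟨a, ha⟩ := σ.exists_forall_parts_eq_zero
  obtain ⟨b, hb⟩ := ν.exists_forall_parts_eq_zero
  obtain ⟨c, hc⟩ := μ.exists_forall_parts_eq_zero
  obtain ⟨n, hσ, hν, hμ⟩ : ∃ n, (∀ i, n ≤ i → σ.parts i = 0) ∧ (∀ i, n ≤ i → ν.parts i = 0) ∧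
      ∀ i, n ≤ i → μ.parts i = 0 :=
    ⟨a + b + c, fun i hi => ha i (by omega), fun i hi => hb i (by omega),
      fun i hi => hc i (by omega)⟩
  rw [sum_dualPart_eq_sum_min (n := n) (fun i hi => by rw [hμ i hi, hν i hi]),
    sum_dualPart_eq_sum_min hσ]
  refine sum_min_le_sum_min_of_dominated σ.antitone hσ
    (sum_parts_le_of_exact ν.antitone μ.antitone hν hμ hf hfg) ?_ m
  have hlen := Module.length_eq_add_of_exact (R := k[X]) (M := MMod k σ.parts)
    (N := MMod k ν.parts) (P := MMod k μ.parts) f g hf hg hfg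
  rw [MMod.length_eq_sum hσ, MMod.length_eq_sum hν, MMod.length_eq_sum hμ] at hlen
  norm_cast at hlen
  rw [hlen, Finset.sum_add_distrib, add_comm]
end

section
/- Let k be an algebraically closed field, let λ and ν be partitions with |λ| = |ν| = n, and let A, B be nilpotent n × n matrices over k of Jordan types λ and ν respectively (i.e., the k[T]-module structure on k^n in which T acts as A is isomorphic to M(λ,k), and the one in which T acts as B is isomorphic to M(ν,k)). Then the following are equivalent: (1) every polynomial in the n² matrix entries with coefficients in k that vanishes on the conjugation orbit {gAg⁻¹ : g ∈ GL_n(k)} also vanishes at B (i.e., B lies in the Zariski closure of the GL_n(k)-conjugation orbit of A); (2) for every m ≥ 1, λ̄₁ + λ̄₂ + … + λ̄_m ≤ ν̄₁ + ν̄₂ + … + ν̄_m, where λ̄, ν̄ denote the dual partitions. -/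
open Polynomial

section
variable {K V V' : Type*} [Field K] [AddCommGroup V] [Module K V] [AddCommGroup V'] [Module K V']
  [FiniteDimensional K V] [FiniteDimensional K V']
open Module

theorem exists_submodule_between {A B : Submodule K V} (hAB : A ≤ B) {r : ℕ}
    (hA : finrank K A ≤ r) (hB : r ≤ finrank K B) :
    ∃ W : Submodule K V, A ≤ W ∧ W ≤ B ∧ finrank K W = r := by
  obtain ⟨C, hC, hsup⟩ := IsModularLattice.exists_disjoint_and_sup_eq hAB
  have hdim := Submodule.finrank_sup_add_finrank_inf_eq A C
  rw [hsup, hC.eq_bot, finrank_bot] at hdim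
  obtain ⟨v, hv⟩ := exists_linearIndependent_of_le_finrank (R := K) (M := C)
    (n := r - finrank K A) (by omega)
  have hv' := hv.map' C.subtype C.ker_subtype
  have hSC : Submodule.span K (Set.range (C.subtype ∘ v)) ≤ C := by
    rw [Submodule.span_le]
    rintro _ ⟨i, rfl⟩
    exact (v i).2
  refine ⟨A ⊔ Submodule.span K (Set.range (C.subtype ∘ v)), le_sup_left,
    sup_le hAB (hSC.trans (hsup ▸ le_sup_right)), ?_⟩
  have hdim' := Submodule.finrank_sup_add_finrank_inf_eq A
    (Submodule.span K (Set.range (C.subtype ∘ v)))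
  rw [(hC.mono_right hSC).eq_bot, finrank_bot, finrank_span_eq_card hv', Fintype.card_fin] at hdim'
  omega

theorem exists_submodule_comparable (c : ℕ → Submodule K V) (hc : Monotone c) {r N : ℕ}
    (h0 : finrank K (c 0) ≤ r) (hN : r ≤ finrank K (c N)) :
    ∃ W : Submodule K V, c 0 ≤ W ∧ finrank K W = r ∧ ∀ j, W ≤ c j ∨ c j ≤ W := by
  classical
  have hex : ∃ j, r ≤ finrank K (c j) := ⟨N, hN⟩
  obtain ⟨j, hj, hmin⟩ : ∃ j, r ≤ finrank K (c j) ∧ ∀ i < j, finrank K (c i) < r :=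
    ⟨Nat.find hex, Nat.find_spec hex, fun i hi => not_le.1 (Nat.find_min hex hi)⟩
  rcases j with _ | j
  · exact ⟨c 0, le_rfl, le_antisymm h0 hj, fun j => Or.inl (hc (Nat.zero_le j))⟩
  · obtain ⟨W, h1, h2, h3⟩ :=
      exists_submodule_between (hc (Nat.le_succ j)) (hmin j (Nat.lt_succ_self j)).le hj
    refine ⟨W, (hc (Nat.zero_le j)).trans h1, h3, fun i => ?_⟩
    rcases Nat.lt_or_ge j i with hi | hi
    · exact Or.inl (h2.trans (hc hi))
    · exact Or.inr ((hc hi).trans h1)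

theorem exists_linearEquiv_extending (hVV' : finrank K V = finrank K V') {p : Submodule K V}
    {q : Submodule K V'} (e : p ≃ₗ[K] q) : ∃ h : V ≃ₗ[K] V', ∀ x : p, h x = e x := by
  obtain ⟨p', hp⟩ := p.exists_isCompl
  obtain ⟨q', hq⟩ := q.exists_isCompl
  have h1 := Submodule.finrank_add_eq_of_isCompl hp
  have h2 := Submodule.finrank_add_eq_of_isCompl hq
  have h3 := e.finrank_eq
  let e' : p' ≃ₗ[K] q' := LinearEquiv.ofFinrankEq _ _ (by omega)
  refine ⟨(Submodule.prodEquivOfIsCompl p p' hp).symm ≪≫ₗ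
    (e.prodCongr e' ≪≫ₗ Submodule.prodEquivOfIsCompl q q' hq), fun x => ?_⟩
  simp

omit [FiniteDimensional K V] in
theorem map_subtype_range_restrict_pow (f : V →ₗ[K] V) {p : Submodule K V}
    (hp : ∀ x ∈ p, f x ∈ p) (m : ℕ) :
    (LinearMap.range (f.restrict hp ^ m)).map p.subtype = p.map (f ^ m) := by
  rw [Module.End.pow_restrict m hp, ← LinearMap.range_comp, LinearMap.subtype_comp_restrict,
    LinearMap.domRestrict, LinearMap.range_comp, Submodule.range_subtype]

omit [FiniteDimensional K V] in
theorem finrank_range_restrict_pow (f : V →ₗ[K] V) {p : Submodule K V}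
    (hp : ∀ x ∈ p, f x ∈ p) (m : ℕ) :
    finrank K (LinearMap.range (f.restrict hp ^ m)) = finrank K (p.map (f ^ m)) := by
  rw [← map_subtype_range_restrict_pow f hp m, Submodule.finrank_map_subtype_eq]

omit [FiniteDimensional K V] in
theorem map_pow_range (f : V →ₗ[K] V) (m : ℕ) :
    (LinearMap.range f).map (f ^ m) = LinearMap.range (f ^ (m + 1)) := by
  rw [pow_succ, Module.End.mul_eq_comp, LinearMap.range_comp]

omit [FiniteDimensional K V] in
theorem coe_restrict_pow_apply (f : V →ₗ[K] V) {p : Submodule K V}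
    (hp : ∀ x ∈ p, f x ∈ p) (m : ℕ) (x : p) :
    (((f.restrict hp ^ m) x : p) : V) = (f ^ m) x := by
  rw [Module.End.pow_restrict m hp]; rfl

theorem finrank_range_lt_of_isNilpotent {f : V →ₗ[K] V} (hf : IsNilpotent f)
    (hV : 0 < finrank K V) : finrank K (LinearMap.range f) < finrank K V := by
  refine lt_of_le_of_ne (Submodule.finrank_le _) fun h => ?_
  have htop := Submodule.eq_top_of_finrank_eq h
  obtain ⟨N, hN⟩ := hf
  have hs : Function.Surjective (f ^ N) := by
    rw [Module.End.coe_pow]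
    exact (LinearMap.range_eq_top.1 htop).iterate N
  rw [hN] at hs
  have hsub : Subsingleton V :=
    ⟨fun a b => by obtain ⟨a, rfl⟩ := hs a; obtain ⟨b, rfl⟩ := hs b; rfl⟩
  exact hV.ne' (finrank_zero_of_subsingleton)

omit [FiniteDimensional K V] in
theorem isNilpotent_restrict {f : V →ₗ[K] V} (hf : IsNilpotent f) {p : Submodule K V}
    (hp : ∀ x ∈ p, f x ∈ p) : IsNilpotent (f.restrict hp) := by
  obtain ⟨N, hN⟩ := hf
  refine ⟨N, LinearMap.ext fun x => Subtype.ext ?_⟩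
  rw [coe_restrict_pow_apply, hN]; rfl

omit [FiniteDimensional K V'] in
theorem finrank_map_add_finrank_ker_of_le (f : V →ₗ[K] V') {W : Submodule K V}
    (hW : LinearMap.ker f ≤ W) :
    finrank K (W.map f) + finrank K (LinearMap.ker f) = finrank K W := by
  have h := LinearMap.finrank_range_add_finrank_ker (f.domRestrict W)
  rw [LinearMap.range_domRestrict, LinearMap.ker_domRestrict] at h
  rw [← h, ← Submodule.finrank_map_subtype_eq W, Submodule.map_comap_subtype,
    inf_eq_right.2 hW]

theorem finrank_range_pow_le_add (f : V →ₗ[K] V) (m : ℕ) :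
    finrank K (LinearMap.range (f ^ m)) + finrank K (LinearMap.range f)
      ≤ finrank K (LinearMap.range (f ^ (m + 1))) + finrank K V := by
  have h := LinearMap.finrank_range_add_finrank_ker (f.domRestrict (LinearMap.range (f ^ m)))
  have h2 := LinearMap.finrank_range_add_finrank_ker f
  rw [LinearMap.range_domRestrict, ← LinearMap.range_comp, ← Module.End.mul_eq_comp,
    ← pow_succ', LinearMap.ker_domRestrict, ← Submodule.finrank_map_subtype_eq,
    Submodule.map_comap_subtype] at h
  have h3 := Submodule.finrank_mono
    (inf_le_right : LinearMap.range (f ^ m) ⊓ LinearMap.ker f ≤ LinearMap.ker f)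
  omega

theorem exists_invariant_submodule_rank_pow_le (f : V →ₗ[K] V) (g : V' →ₗ[K] V')
    (hf : IsNilpotent f) (hdim : finrank K V = finrank K V')
    (hr : ∀ m, finrank K (LinearMap.range (g ^ m)) ≤ finrank K (LinearMap.range (f ^ m))) :
    ∃ W : Submodule K V', LinearMap.range g ≤ W ∧
      finrank K W = finrank K (LinearMap.range f) ∧
      ∀ m, finrank K (W.map (g ^ m)) ≤ finrank K (LinearMap.range (f ^ (m + 1))) := by
  obtain ⟨N, hN⟩ := hf
  have hgN : g ^ N = 0 := by
    have h := hr N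
    rw [hN, LinearMap.range_zero, finrank_bot, Nat.le_zero, Submodule.finrank_eq_zero] at h
    exact LinearMap.range_eq_bot.1 h
  obtain ⟨W, h0, hW, hcomp⟩ := exists_submodule_comparable
    (fun j => LinearMap.range g ⊔ LinearMap.ker (g ^ j))
    (fun i j hij => sup_le_sup_left (fun x hx => by
      rw [LinearMap.mem_ker] at hx ⊢
      rw [← Nat.sub_add_cancel hij, pow_add, Module.End.mul_apply, hx, map_zero]) _)
    (r := finrank K (LinearMap.range f)) (N := N)
    (by
      have h1 := hr 1
      rw [pow_one, pow_one] at h1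
      rwa [pow_zero, Module.End.one_eq_id, LinearMap.ker_id, sup_bot_eq])
    (by
      rw [hgN, LinearMap.ker_zero, sup_top_eq, finrank_top]
      exact hdim ▸ Submodule.finrank_le _)
  refine ⟨W, le_sup_left.trans h0, hW, fun m => ?_⟩
  rcases hcomp m with h | h
  · refine le_trans (Submodule.finrank_mono (?_ : _ ≤ LinearMap.range (g ^ (m + 1)))) (hr (m + 1))
    refine (Submodule.map_mono h).trans ?_
    rw [Submodule.map_sup, map_pow_range]
    refine sup_le le_rfl ?_
    rw [LinearMap.le_ker_iff_map.1 le_rfl]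
    exact bot_le
  · have h1 := finrank_map_add_finrank_ker_of_le (g ^ m) (le_sup_right.trans h)
    have h2 := LinearMap.finrank_range_add_finrank_ker (g ^ m)
    have h3 := hr m
    have h4 := finrank_range_pow_le_add f m
    omega

omit [FiniteDimensional K V] [FiniteDimensional K V'] in
theorem exists_linearEquiv_range_pow_aux (d : ℕ) :
    ∀ (V : Type*) (V' : Type*) [AddCommGroup V] [Module K V] [AddCommGroup V'] [Module K V']
    [FiniteDimensional K V] [FiniteDimensional K V'] (f : V →ₗ[K] V) (g : V' →ₗ[K] V'),
    IsNilpotent f → finrank K V = d → finrank K V' = d →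
    (∀ m, finrank K (LinearMap.range (g ^ m)) ≤ finrank K (LinearMap.range (f ^ m))) →
    ∃ h : V ≃ₗ[K] V', ∀ i x, ∃ y, g (h ((f ^ i) x)) = h ((f ^ (i + 1)) y) := by
  induction d using Nat.strong_induction_on with
  | _ d ih =>
  intro V V' _ _ _ _ _ _ f g hf hV hV' hr
  rcases Nat.eq_zero_or_pos d with rfl | hd
  · have := finrank_zero_iff.1 hV'
    exact ⟨LinearEquiv.ofFinrankEq _ _ (hV.trans hV'.symm),
      fun i x => ⟨0, Subsingleton.elim _ _⟩⟩
  obtain ⟨W, hgW, hW, hWr⟩ :=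
    exists_invariant_submodule_rank_pow_le f g hf (hV.trans hV'.symm) hr
  have hp : ∀ x ∈ LinearMap.range f, f x ∈ LinearMap.range f := fun x _ => ⟨x, rfl⟩
  have hq : ∀ x ∈ W, g x ∈ W := fun x _ => hgW ⟨x, rfl⟩
  obtain ⟨e, he⟩ := ih (finrank K (LinearMap.range f))
    (hV ▸ finrank_range_lt_of_isNilpotent hf (hV ▸ hd)) (LinearMap.range f) W
    (f.restrict hp) (g.restrict hq) (isNilpotent_restrict hf hp) rfl hW
    (fun m => by
      rw [finrank_range_restrict_pow, finrank_range_restrict_pow, map_pow_range]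
      exact hWr m)
  obtain ⟨h, hh⟩ := exists_linearEquiv_extending (hV.trans hV'.symm) e
  refine ⟨h, fun i x => ?_⟩
  rcases i with _ | i
  · obtain ⟨⟨_, y, rfl⟩, hz⟩ := e.surjective ⟨g (h x), hgW ⟨_, rfl⟩⟩
    refine ⟨y, ?_⟩
    have := hh ⟨f y, y, rfl⟩
    rw [hz] at this
    simpa using this.symm
  · obtain ⟨⟨_, y, rfl⟩, hy⟩ := he i ⟨f x, x, rfl⟩
    refine ⟨y, ?_⟩
    have h1 := congrArg Subtype.val hy
    rw [LinearMap.coe_restrict_apply, ← hh, ← hh, coe_restrict_pow_apply,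
      coe_restrict_pow_apply] at h1
    simpa only [pow_succ, Module.End.mul_apply] using h1

/-- If the powers of `g` have at most the rank of those of the nilpotent `f`, then some conjugate of
`g` maps `range (f ^ i)` into `range (f ^ (i + 1))` for all `i`. -/
theorem exists_linearEquiv_range_pow {f : V →ₗ[K] V} {g : V' →ₗ[K] V'} (hf : IsNilpotent f)
    (hdim : finrank K V = finrank K V')
    (hr : ∀ m, finrank K (LinearMap.range (g ^ m)) ≤ finrank K (LinearMap.range (f ^ m))) :
    ∃ h : V ≃ₗ[K] V', ∀ i x, ∃ y, g (h ((f ^ i) x)) = h ((f ^ (i + 1)) y) :=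
  exists_linearEquiv_range_pow_aux _ V V' f g hf rfl hdim.symm hr

theorem exists_linearEquiv_intertwining_of_range {f : V →ₗ[K] V} {g : V' →ₗ[K] V'}
    (hdim : finrank K V = finrank K V') (e : LinearMap.range f ≃ₗ[K] LinearMap.range g)
    (he : ∀ x, g (e (f.rangeRestrict x)) = e ⟨f (f x), f x, rfl⟩) :
    ∃ h : V ≃ₗ[K] V', ∀ x, g (h x) = h (f x) := by
  obtain ⟨s, hs⟩ := LinearMap.exists_rightInverse_of_surjective g.rangeRestrict
    (LinearMap.range_rangeRestrict g)
  have hs' : ∀ w, g (s w) = w := fun w => congrArg Subtype.val (LinearMap.congr_fun hs w)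
  let L : V →ₗ[K] V' := s ∘ₗ e.toLinearMap ∘ₗ f.rangeRestrict
  have hL : ∀ x, g (L x) = e (f.rangeRestrict x) := fun x => hs' _
  let δ : LinearMap.range f →ₗ[K] LinearMap.ker g :=
    LinearMap.codRestrict (LinearMap.ker g)
      ((LinearMap.range g).subtype ∘ₗ e.toLinearMap - L ∘ₗ (LinearMap.range f).subtype) (by
        rintro ⟨_, x, rfl⟩
        rw [LinearMap.mem_ker, LinearMap.sub_apply, map_sub, sub_eq_zero]
        exact (he x).trans (hL (f x)).symm)
  obtain ⟨D, hD⟩ := LinearMap.exists_extend δ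
  let H : V →ₗ[K] V' := L + (LinearMap.ker g).subtype ∘ₗ D
  have hgH : ∀ x, g (H x) = e (f.rangeRestrict x) := fun x => by
    have : g (D x) = 0 := (D x).2
    simp [H, hL, this]
  have hHe : ∀ w : LinearMap.range f, H w = e w := fun w => by
    have h1 : (D w : V') = e w - L w := congrArg Subtype.val (LinearMap.congr_fun hD w)
    simp [H, h1]
  have hdisj : Disjoint (LinearMap.range f) (LinearMap.ker H) := by
    rw [Submodule.disjoint_def]
    intro x hx hx0
    have h1 := hHe ⟨x, hx⟩
    rw [LinearMap.mem_ker.1 hx0] at h1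
    have h2 : e ⟨x, hx⟩ = 0 := Subtype.ext h1.symm
    simpa using h2
  obtain ⟨c, hc, hcompl⟩ := hdisj.exists_isCompl
  have hker : LinearMap.ker H ≤ LinearMap.ker f := fun x hx => by
    have h1 := hgH x
    rw [LinearMap.mem_ker.1 hx, map_zero] at h1
    have h2 : e (f.rangeRestrict x) = 0 := Subtype.ext h1.symm
    rw [LinearEquiv.map_eq_zero_iff] at h2
    exact congrArg Subtype.val h2
  have hmap : (LinearMap.ker f).map H ≤ LinearMap.ker g := by
    rintro _ ⟨x, hx, rfl⟩
    have h2 : f.rangeRestrict x = 0 := Subtype.ext hx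
    rw [LinearMap.mem_ker, hgH, h2, map_zero]; rfl
  obtain ⟨C, hC, hsup⟩ := IsModularLattice.exists_disjoint_and_sup_eq hmap
  have hCg : C ≤ LinearMap.ker g := hsup ▸ le_sup_right
  have hCdim : finrank K (LinearMap.ker H) = finrank K C := by
    have h1 := finrank_map_add_finrank_ker_of_le H hker
    have h2 := Submodule.finrank_sup_add_finrank_inf_eq ((LinearMap.ker f).map H) C
    rw [hsup, hC.eq_bot, finrank_bot] at h2
    have h3 := LinearMap.finrank_range_add_finrank_ker f
    have h4 := LinearMap.finrank_range_add_finrank_ker g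
    have h5 := e.finrank_eq
    omega
  let φ : LinearMap.ker H ≃ₗ[K] C := LinearEquiv.ofFinrankEq _ _ hCdim
  let π := Submodule.projectionOnto (LinearMap.ker H) c hcompl.symm
  let F : V →ₗ[K] V' := H + C.subtype ∘ₗ φ.toLinearMap ∘ₗ π
  have hFx : ∀ x, F x = H x + φ (π x) := fun x => rfl
  have hinj : Function.Injective F := by
    rw [← LinearMap.ker_eq_bot, Submodule.eq_bot_iff]
    intro x hx
    rw [LinearMap.mem_ker, hFx] at hx
    have hgx : H x ∈ LinearMap.ker g := by
      rw [eq_neg_of_add_eq_zero_left hx]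
      exact neg_mem (hCg (φ (π x)).2)
    have hfx : x ∈ LinearMap.ker f := by
      have h1 := hgH x
      rw [LinearMap.mem_ker.1 hgx] at h1
      have h2 : e (f.rangeRestrict x) = 0 := Subtype.ext h1.symm
      rw [LinearEquiv.map_eq_zero_iff] at h2
      exact congrArg Subtype.val h2
    have hHx : H x = 0 := by
      refine Submodule.disjoint_def.1 hC _ ⟨x, hfx, rfl⟩ ?_
      rw [eq_neg_of_add_eq_zero_left hx]
      exact neg_mem (φ (π x)).2
    have hπ : π x = 0 := by
      rw [hHx, zero_add] at hx
      have h2 : φ (π x) = 0 := Subtype.ext hx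
      simpa using h2
    have h3 : π x = ⟨x, hHx⟩ := Submodule.projectionOnto_apply_left hcompl.symm ⟨x, hHx⟩
    rw [hπ] at h3
    exact (congrArg Subtype.val h3).symm
  refine ⟨LinearEquiv.ofInjectiveOfFinrankEq F hinj hdim, fun x => ?_⟩
  have hπ0 : π (f x) = 0 :=
    Submodule.projectionOnto_apply_of_mem_right hcompl.symm (hc ⟨x, rfl⟩)
  have hgC : g (φ (π x)) = 0 := hCg (φ (π x)).2
  have h1 := hHe ⟨f x, x, rfl⟩
  change g (F x) = F (f x)
  rw [hFx, hFx, map_add, hgC, add_zero, hπ0, map_zero, hgH]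
  rw [ZeroMemClass.coe_zero, add_zero]
  exact h1.symm

omit [FiniteDimensional K V] [FiniteDimensional K V'] in
theorem exists_linearEquiv_intertwining_aux (d : ℕ) :
    ∀ (V : Type*) (V' : Type*) [AddCommGroup V] [Module K V] [AddCommGroup V'] [Module K V']
    [FiniteDimensional K V] [FiniteDimensional K V'] (f : V →ₗ[K] V) (g : V' →ₗ[K] V'),
    IsNilpotent f → finrank K V = d → finrank K V' = d →
    (∀ m, finrank K (LinearMap.range (f ^ m)) = finrank K (LinearMap.range (g ^ m))) →
    ∃ h : V ≃ₗ[K] V', ∀ x, g (h x) = h (f x) := by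
  induction d using Nat.strong_induction_on with
  | _ d ih =>
  intro V V' _ _ _ _ _ _ f g hf hV hV' hr
  rcases Nat.eq_zero_or_pos d with rfl | hd
  · have := finrank_zero_iff.1 hV'
    exact ⟨LinearEquiv.ofFinrankEq _ _ (hV.trans hV'.symm), fun x => Subsingleton.elim _ _⟩
  have hp : ∀ x ∈ LinearMap.range f, f x ∈ LinearMap.range f := fun x _ => ⟨x, rfl⟩
  have hq : ∀ x ∈ LinearMap.range g, g x ∈ LinearMap.range g := fun x _ => ⟨x, rfl⟩
  obtain ⟨e, he⟩ := ih (finrank K (LinearMap.range f))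
    (hV ▸ finrank_range_lt_of_isNilpotent hf (hV ▸ hd)) (LinearMap.range f) (LinearMap.range g)
    (f.restrict hp) (g.restrict hq) (isNilpotent_restrict hf hp) rfl
    (by have h1 := hr 1; rw [pow_one, pow_one] at h1; exact h1.symm)
    (fun m => by
      rw [finrank_range_restrict_pow, finrank_range_restrict_pow, map_pow_range, map_pow_range]
      exact hr (m + 1))
  exact exists_linearEquiv_intertwining_of_range (hV.trans hV'.symm) e
    fun x => congrArg Subtype.val (he (f.rangeRestrict x))

/-- Nilpotent endomorphisms whose powers have the same ranks are conjugate. -/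
theorem exists_linearEquiv_intertwining {f : V →ₗ[K] V} {g : V' →ₗ[K] V'} (hf : IsNilpotent f)
    (hdim : finrank K V = finrank K V')
    (hr : ∀ m, finrank K (LinearMap.range (f ^ m)) = finrank K (LinearMap.range (g ^ m))) :
    ∃ h : V ≃ₗ[K] V', ∀ x, g (h x) = h (f x) :=
  exists_linearEquiv_intertwining_aux _ V V' f g hf rfl hdim.symm hr

end

section
open Module
variable {K : Type*} [Field K]

theorem rank_pow_eq_finrank {n : ℕ} (M : Matrix (Fin n) (Fin n) K) (m : ℕ) :
    (M ^ m).rank = finrank K (LinearMap.range (M.mulVecLin ^ m)) := by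
  rw [Matrix.rank, ← Matrix.toLin'_apply', Matrix.toLin'_pow, Matrix.toLin'_apply']

theorem isNilpotent_mulVecLin {n : ℕ} {M : Matrix (Fin n) (Fin n) K} (hM : IsNilpotent M) :
    IsNilpotent M.mulVecLin := by
  obtain ⟨N, hN⟩ := hM
  refine ⟨N, ?_⟩
  rw [← Matrix.toLin'_apply', ← Matrix.toLin'_pow, hN, map_zero]

theorem exists_mul_mul_eq_one {n : ℕ} (M : Matrix (Fin n) (Fin n) K) :
    ∃ (U : Matrix (Fin M.rank) (Fin n) K) (V : Matrix (Fin n) (Fin M.rank) K),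
      U * M * V = 1 := by
  let φ : (Fin M.rank → K) ≃ₗ[K] LinearMap.range M.mulVecLin :=
    LinearEquiv.ofFinrankEq _ _ (by rw [finrank_fin_fun]; rfl)
  obtain ⟨s, hs⟩ := LinearMap.exists_rightInverse_of_surjective M.mulVecLin.rangeRestrict
    (LinearMap.range_rangeRestrict _)
  obtain ⟨u, hu⟩ := LinearMap.exists_leftInverse_of_injective
    ((LinearMap.range M.mulVecLin).subtype ∘ₗ φ.toLinearMap)
    (LinearMap.ker_eq_bot.2 (Subtype.val_injective.comp φ.injective))
  refine ⟨LinearMap.toMatrix' u, LinearMap.toMatrix' (s ∘ₗ φ.toLinearMap), ?_⟩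
  apply Matrix.toLin'.injective
  rw [Matrix.toLin'_mul, Matrix.toLin'_mul, Matrix.toLin'_toMatrix', Matrix.toLin'_toMatrix',
    Matrix.toLin'_one]
  ext1 i
  refine LinearMap.ext fun x => ?_
  have h1 : M.mulVecLin (s (φ (Pi.single i x))) = φ (Pi.single i x) :=
    congrArg Subtype.val (LinearMap.congr_fun hs (φ (Pi.single i x)))
  have h2 := LinearMap.congr_fun hu (Pi.single i x)
  simp only [LinearMap.comp_apply, LinearEquiv.coe_coe, Submodule.subtype_apply,
    Matrix.toLin'_apply', LinearMap.single_apply] at h2 ⊢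
  rw [h1, h2]

theorem le_rank_of_det_mul_mul_ne_zero {n r : ℕ} {M : Matrix (Fin n) (Fin n) K}
    {U : Matrix (Fin r) (Fin n) K} {V : Matrix (Fin n) (Fin r) K}
    (h : (U * M * V).det ≠ 0) : r ≤ M.rank := by
  have h1 := Matrix.rank_of_det_ne_zero h
  rw [Fintype.card_fin] at h1
  calc r = (U * M * V).rank := h1.symm
    _ ≤ (U * M).rank := Matrix.rank_mul_le_left _ _
    _ ≤ M.rank := Matrix.rank_mul_le_right _ _

theorem exists_conj_of_linearEquiv {n : ℕ} {A B : Matrix (Fin n) (Fin n) K}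
    (h : (Fin n → K) ≃ₗ[K] (Fin n → K))
    (hAB : ∀ x, B.mulVecLin (h x) = h (A.mulVecLin x)) :
    ∃ g : GL (Fin n) K, B = (g : Matrix (Fin n) (Fin n) K) * A *
      ((g⁻¹ : GL (Fin n) K) : Matrix (Fin n) (Fin n) K) := by
  let g : GL (Fin n) K :=
    ⟨LinearMap.toMatrix' h.toLinearMap, LinearMap.toMatrix' h.symm.toLinearMap,
    by rw [← LinearMap.toMatrix'_comp]; simp, by rw [← LinearMap.toMatrix'_comp]; simp⟩
  have hg : (g : Matrix (Fin n) (Fin n) K).mulVecLin = h := Matrix.toLin'_toMatrix' _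
  refine ⟨g, ?_⟩
  rw [Units.eq_mul_inv_iff_mul_eq]
  apply Matrix.toLin'.injective
  rw [Matrix.toLin'_mul, Matrix.toLin'_mul, Matrix.toLin'_apply', Matrix.toLin'_apply',
    Matrix.toLin'_apply', hg]
  exact LinearMap.ext hAB

theorem conj_pow_matrix {n : ℕ} (g : GL (Fin n) K) (A : Matrix (Fin n) (Fin n) K) (m : ℕ) :
    ((g : Matrix (Fin n) (Fin n) K) * A * ((g⁻¹ : GL (Fin n) K) : Matrix (Fin n) (Fin n) K)) ^ m =
      (g : Matrix (Fin n) (Fin n) K) * A ^ m *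
        ((g⁻¹ : GL (Fin n) K) : Matrix (Fin n) (Fin n) K) :=
  Units.conj_pow g A m

theorem rank_conj {n : ℕ} (g : GL (Fin n) K) (A : Matrix (Fin n) (Fin n) K) :
    ((g : Matrix (Fin n) (Fin n) K) * A *
      ((g⁻¹ : GL (Fin n) K) : Matrix (Fin n) (Fin n) K)).rank = A.rank := by
  rw [Matrix.rank_mul_eq_left_of_isUnit_det _ _ (Matrix.isUnits_det_units g⁻¹),
    Matrix.rank_mul_eq_right_of_isUnit_det _ _ (Matrix.isUnits_det_units g)]

theorem range_pow_add_smul_le {V : Type*} [AddCommGroup V] [Module K V] {f g : V →ₗ[K] V}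
    (hfg : ∀ i x, ∃ y, g ((f ^ i) x) = (f ^ (i + 1)) y) (t : K) (m : ℕ) :
    LinearMap.range ((f + t • (g - f)) ^ m) ≤ LinearMap.range (f ^ m) := by
  induction m with
  | zero => exact le_rfl
  | succ m ih =>
    rintro _ ⟨x, rfl⟩
    obtain ⟨y, hy⟩ := ih ⟨x, rfl⟩
    obtain ⟨z, hz⟩ := hfg m y
    rw [pow_succ' (f + t • (g - f)), Module.End.mul_apply, ← hy]
    refine ⟨y + t • (z - y), ?_⟩
    simp only [LinearMap.add_apply, LinearMap.smul_apply, LinearMap.sub_apply, hz, map_add,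
      map_smul, map_sub, pow_succ' f m, Module.End.mul_apply]

theorem exists_conj_of_rank_pow_eq {n : ℕ} {A B : Matrix (Fin n) (Fin n) K} (hA : IsNilpotent A)
    (hr : ∀ m, (A ^ m).rank = (B ^ m).rank) :
    ∃ g : GL (Fin n) K, B = (g : Matrix (Fin n) (Fin n) K) * A *
      ((g⁻¹ : GL (Fin n) K) : Matrix (Fin n) (Fin n) K) := by
  obtain ⟨h, hh⟩ := exists_linearEquiv_intertwining (g := B.mulVecLin) (isNilpotent_mulVecLin hA) rfl
    fun m => by rw [← rank_pow_eq_finrank, ← rank_pow_eq_finrank, hr]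
  exact exists_conj_of_linearEquiv h hh

theorem rank_pow_le_of_mem_orbit_closure {n : ℕ} {A B : Matrix (Fin n) (Fin n) K}
    (hAB : ∀ P : MvPolynomial (Fin n × Fin n) K,
        (∀ g : GL (Fin n) K,
          MvPolynomial.eval
            (fun p => ((g : Matrix (Fin n) (Fin n) K) * A *
              ((g⁻¹ : GL (Fin n) K) : Matrix (Fin n) (Fin n) K)) p.1 p.2) P = 0) →
        MvPolynomial.eval (fun p => B p.1 p.2) P = 0) (m : ℕ) :
    (B ^ m).rank ≤ (A ^ m).rank := by
  obtain ⟨U, V, hUV⟩ := exists_mul_mul_eq_one (B ^ m)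
  let U' : Matrix _ _ (MvPolynomial (Fin n × Fin n) K) := U.map MvPolynomial.C
  let V' : Matrix _ _ (MvPolynomial (Fin n × Fin n) K) := V.map MvPolynomial.C
  let P : MvPolynomial (Fin n × Fin n) K :=
    (U' * Matrix.mvPolynomialX (Fin n) (Fin n) K ^ m * V').det
  have hP : ∀ M : Matrix (Fin n) (Fin n) K,
      MvPolynomial.eval (fun p => M p.1 p.2) P = (U * M ^ m * V).det := fun M => by
    have hU : ∀ {r s : ℕ} (U : Matrix (Fin r) (Fin s) K),
        (U.map MvPolynomial.C).map (MvPolynomial.eval fun p : Fin n × Fin n => M p.1 p.2) = U :=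
      fun U => by ext; simp
    have hX : (MvPolynomial.eval fun p : Fin n × Fin n => M p.1 p.2).mapMatrix
        (Matrix.mvPolynomialX (Fin n) (Fin n) K) = M := by ext; simp
    rw [RingHom.map_det, RingHom.mapMatrix_apply, Matrix.map_mul, Matrix.map_mul, hU, hU,
      ← RingHom.mapMatrix_apply, map_pow, hX]
  by_contra hlt
  have h0 := hAB P fun g => by
    rw [hP]
    by_contra hne
    have h1 := le_rank_of_det_mul_mul_ne_zero hne
    rw [conj_pow_matrix, rank_conj] at h1
    exact hlt h1
  rw [hP, hUV, Matrix.det_one] at h0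
  exact one_ne_zero h0

theorem mem_orbit_closure_of_rank_pow_le [Infinite K] {n : ℕ} {A B : Matrix (Fin n) (Fin n) K}
    (hA : IsNilpotent A) (hr : ∀ m, (B ^ m).rank ≤ (A ^ m).rank)
    (P : MvPolynomial (Fin n × Fin n) K)
    (hP : ∀ g : GL (Fin n) K,
      MvPolynomial.eval
        (fun p => ((g : Matrix (Fin n) (Fin n) K) * A *
          ((g⁻¹ : GL (Fin n) K) : Matrix (Fin n) (Fin n) K)) p.1 p.2) P = 0) :
    MvPolynomial.eval (fun p => B p.1 p.2) P = 0 := by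
  obtain ⟨h, hh⟩ := exists_linearEquiv_range_pow (g := B.mulVecLin) (isNilpotent_mulVecLin hA) rfl
    fun m => by rw [← rank_pow_eq_finrank, ← rank_pow_eq_finrank]; exact hr m
  let A' : Matrix (Fin n) (Fin n) K :=
    LinearMap.toMatrix' (h.toLinearMap ∘ₗ A.mulVecLin ∘ₗ h.symm.toLinearMap)
  have hA'lin : A'.mulVecLin = h.toLinearMap ∘ₗ A.mulVecLin ∘ₗ h.symm.toLinearMap :=
    Matrix.toLin'_toMatrix' _
  have hA'h : ∀ x, A'.mulVecLin (h x) = h (A.mulVecLin x) := fun x => by simp [hA'lin]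
  have hA'pow : ∀ i x, (A'.mulVecLin ^ i) (h x) = h ((A.mulVecLin ^ i) x) := by
    intro i
    induction i with
    | zero => exact fun x => rfl
    | succ i ih =>
        intro x
        rw [pow_succ', Module.End.mul_apply, ih, hA'h, pow_succ', Module.End.mul_apply]
  obtain ⟨g, hg⟩ := exists_conj_of_linearEquiv h hA'h
  have hA'rank : ∀ m, (A' ^ m).rank = (A ^ m).rank := fun m => by rw [hg, conj_pow_matrix, rank_conj]
  have hBA' : ∀ i x, ∃ y, B.mulVecLin ((A'.mulVecLin ^ i) x) = (A'.mulVecLin ^ (i + 1)) y := by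
    intro i x
    obtain ⟨x, rfl⟩ := h.surjective x
    obtain ⟨y, hy⟩ := hh i x
    exact ⟨h y, by rw [hA'pow, hA'pow, hy]⟩
  have hle : ∀ (t : K) m, ((A' + t • (B - A')) ^ m).rank ≤ (A ^ m).rank := fun t m => by
    rw [← hA'rank, rank_pow_eq_finrank, rank_pow_eq_finrank]
    have hlin : (A' + t • (B - A')).mulVecLin =
        A'.mulVecLin + t • (B.mulVecLin - A'.mulVecLin) := by
      simp only [← Matrix.toLin'_apply', map_add, map_smul, map_sub]
    rw [hlin]
    exact Submodule.finrank_mono (range_pow_add_smul_le hBA' t m)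
  choose U V hUV using fun m => exists_mul_mul_eq_one (A' ^ m)
  let L : Matrix (Fin n) (Fin n) K[X] := A'.map C + (X : K[X]) • (B - A').map C
  have hL : ∀ t, L.map (eval t) = A' + t • (B - A') := fun t => by ext; simp [L]
  let q : ℕ → K[X] := fun m => ((U m).map C * L ^ m * (V m).map C).det
  have hq : ∀ t m, (q m).eval t = (U m * (A' + t • (B - A')) ^ m * V m).det := fun t m => by
    have hC : ∀ {r s : ℕ} (U : Matrix (Fin r) (Fin s) K),
        (U.map C).map (evalRingHom t) = U := fun U => by ext; simp
    have hL' : (evalRingHom t).mapMatrix L = A' + t • (B - A') := hL t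
    rw [← coe_evalRingHom, RingHom.map_det, RingHom.mapMatrix_apply, Matrix.map_mul,
      Matrix.map_mul, hC, hC, ← RingHom.mapMatrix_apply, map_pow, hL']
  obtain ⟨N, hN⟩ := hA
  let p : K[X] := MvPolynomial.eval₂ C (fun ij => L ij.1 ij.2) P
  have hp : ∀ t, p.eval t =
      MvPolynomial.eval (fun ij => (A' + t • (B - A')) ij.1 ij.2) P := fun t => by
    rw [← hL, ← coe_evalRingHom, MvPolynomial.eval₂_comp_left, MvPolynomial.eval]
    congr 1
    ext; simp
  have hzero : (∏ m ∈ Finset.range N, q m) * p = 0 := by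
    refine Polynomial.funext fun t => ?_
    rw [eval_mul, eval_zero, mul_eq_zero]
    by_contra! hne
    rw [eval_prod, Finset.prod_ne_zero_iff] at hne
    obtain ⟨g, hg⟩ := exists_conj_of_rank_pow_eq (A := A) (B := A' + t • (B - A')) ⟨N, hN⟩
      fun m => by
        refine le_antisymm ?_ (hle t m)
        rcases Nat.lt_or_ge m N with hm | hm
        · have h1 := hne.1 m (Finset.mem_range.2 hm)
          rw [hq] at h1
          exact hA'rank m ▸ le_rank_of_det_mul_mul_ne_zero h1
        · rw [pow_eq_zero_of_le hm hN, Matrix.rank_zero]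
          exact Nat.zero_le _
    apply hne.2
    rw [hp, hg]
    exact hP g
  have hq0 : ∏ m ∈ Finset.range N, q m ≠ 0 := by
    refine Finset.prod_ne_zero_iff.2 fun m _ h0 => ?_
    have h1 := hq 0 m
    rw [h0, zero_smul, add_zero, hUV, Matrix.det_one, eval_zero] at h1
    exact zero_ne_one h1
  have h1 := hp 1
  rw [(mul_eq_zero.1 hzero).resolve_left hq0, eval_zero, one_smul, add_sub_cancel] at h1
  exact h1.symm

end

section
open Module
variable {k : Type} [Field k]

theorem exists_basis_quotient_X_pow (a : ℕ) :
    ∃ b : Basis (Fin a) k (k[X] ⧸ Ideal.span {(X : k[X]) ^ a}),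
      ∀ j, b j = Ideal.Quotient.mk _ (X ^ (j : ℕ)) := by
  let pb := AdjoinRoot.powerBasis' (monic_X_pow (R := k) a)
  have hdim : pb.dim = a := natDegree_X_pow a
  refine ⟨pb.basis.reindex (finCongr hdim), fun j => ?_⟩
  change (pb.basis.reindex (finCongr hdim)) j = AdjoinRoot.mk _ (X ^ (j : ℕ))
  rw [Basis.reindex_apply, pb.basis_eq_pow, map_pow, AdjoinRoot.mk_X]
  rfl

theorem exists_basis_MMod (lam : ℕ → ℕ) :
    ∃ b : Basis (Σ i, Fin (lam i)) k (MMod k lam),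
      ∀ p, b p = DirectSum.of (fun i => k[X] ⧸ Ideal.span {(X : k[X]) ^ lam i}) p.1
        (Ideal.Quotient.mk _ (X ^ (p.2 : ℕ))) := by
  classical
  choose b hb using fun i => exists_basis_quotient_X_pow (k := k) (lam i)
  refine ⟨DFinsupp.basis b, fun p => ?_⟩
  rw [← hb]
  rw [← (DFinsupp.basis b).repr_symm_single_one p]
  obtain ⟨i, j⟩ := p
  change DFinsupp.mapRange (fun i x => (b i).repr.symm x) (fun i => map_zero _)
    (sigmaFinsuppEquivDFinsupp (Finsupp.single (⟨i, j⟩ : Σ i, Fin (lam i)) (1 : k))) =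
      DFinsupp.single i (b i j)
  rw [sigmaFinsuppEquivDFinsupp_single]
  rw [DFinsupp.mapRange_single]
  simp

theorem rank_pow_eq_card {n : ℕ} {lam : ℕ → ℕ} {A : Matrix (Fin n) (Fin n) k}
    (E : Module.AEval' A.mulVecLin ≃ₗ[k[X]] MMod k lam) (m : ℕ) :
    Finite (Σ i, Fin (lam i)) ∧ Nat.card (Σ i, Fin (lam i)) = n ∧
    finrank k (LinearMap.range (A.mulVecLin ^ m)) =
      Nat.card {p : Σ i, Fin (lam i) // m ≤ (p.2 : ℕ)} := by
  obtain ⟨b, hb⟩ := exists_basis_MMod (k := k) lam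
  let w : Basis (Σ i, Fin (lam i)) k (Fin n → k) :=
    b.map ((E.restrictScalars k).symm ≪≫ₗ (Module.AEval'.of A.mulVecLin).symm)
  have hfin : Finite (Σ i, Fin (lam i)) := Module.Finite.finite_basis w
  have hw : ∀ p, AEval'.of A.mulVecLin (w p) = E.symm (b p) := fun p => by
    simp only [w, Basis.map_apply, LinearEquiv.trans_apply, LinearEquiv.apply_symm_apply]
    rfl
  have hpow : ∀ p, AEval'.of A.mulVecLin ((A.mulVecLin ^ m) (w p)) =
      E.symm (DirectSum.of (fun i => k[X] ⧸ Ideal.span {(X : k[X]) ^ lam i}) p.1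
        (Ideal.Quotient.mk _ (X ^ (m + (p.2 : ℕ))))) := fun p => by
    have h1 := AEval'.X_pow_smul_of A.mulVecLin (w p) m
    rw [Module.End.smul_def] at h1
    rw [← h1, hw, hb, ← map_smul, ← DirectSum.lof_eq_of k[X], ← map_smul, pow_add, map_mul]
    rfl
  have hpow1 : ∀ (i : ℕ) (j : ℕ) (hj : j < lam i) (h : m + j < lam i),
      (A.mulVecLin ^ m) (w ⟨i, j, hj⟩) = w ⟨i, m + j, h⟩ := fun i j hj h => by
    apply (AEval'.of A.mulVecLin).injective
    rw [hpow, hw, hb]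
  have hpow2 : ∀ (i : ℕ) (j : ℕ) (hj : j < lam i) (_ : lam i ≤ m + j),
      (A.mulVecLin ^ m) (w ⟨i, j, hj⟩) = 0 := fun i j hj h => by
    apply (AEval'.of A.mulVecLin).injective
    have h0 : Ideal.Quotient.mk (Ideal.span {(X : k[X]) ^ lam i}) (X ^ (m + j)) = 0 :=
      Ideal.Quotient.eq_zero_iff_mem.2 (Ideal.mem_span_singleton.2 (pow_dvd_pow _ h))
    rw [hpow, h0, map_zero, map_zero, map_zero]
  refine ⟨hfin, by rw [← finrank_eq_nat_card_basis w, finrank_fin_fun], ?_⟩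
  have hspan : LinearMap.range (A.mulVecLin ^ m) = Submodule.span k
      (Set.range fun p : {p : Σ i, Fin (lam i) // m ≤ (p.2 : ℕ)} => w p) := by
    rw [LinearMap.range_eq_map, ← w.span_eq, Submodule.map_span]
    apply le_antisymm
    · rw [Submodule.span_le]
      rintro _ ⟨_, ⟨⟨i, j, hj⟩, rfl⟩, rfl⟩
      rcases Nat.lt_or_ge (m + j) (lam i) with h | h
      · rw [hpow1 i j hj h]
        exact Submodule.subset_span ⟨⟨⟨i, m + j, h⟩, Nat.le_add_right m j⟩, rfl⟩
      · rw [hpow2 i j hj h]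
        exact zero_mem _
    · rw [Submodule.span_le]
      rintro _ ⟨⟨⟨i, j, hj⟩, hmj⟩, rfl⟩
      obtain ⟨j, rfl⟩ := Nat.exists_eq_add_of_le hmj
      exact Submodule.subset_span ⟨_, ⟨⟨i, j, by omega⟩, rfl⟩, hpow1 i j (by omega) hj⟩
  have := Fintype.ofFinite {p : Σ i, Fin (lam i) // m ≤ (p.2 : ℕ)}
  rw [hspan, finrank_span_eq_card (b := fun p : {p : Σ i, Fin (lam i) // m ≤ (p.2 : ℕ)} => w p)
    (w.linearIndependent.comp _ Subtype.val_injective),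
    Nat.card_eq_fintype_card]

theorem card_sigma_fin_lt (lam : ℕ → ℕ) [Finite (Σ i, Fin (lam i))] (m : ℕ) :
    Nat.card {p : Σ i, Fin (lam i) // ¬ m ≤ (p.2 : ℕ)} =
      ∑ j ∈ Finset.range m, dualPart lam (j + 1) := by
  let e : {p : Σ i, Fin (lam i) // ¬ m ≤ (p.2 : ℕ)} ≃ Σ j : Fin m, {i : ℕ | (j : ℕ) + 1 ≤ lam i} :=
    { toFun := fun p => ⟨⟨p.1.2, not_le.1 p.2⟩, ⟨p.1.1, p.1.2.2⟩⟩
      invFun := fun q => ⟨⟨q.2.1, ⟨q.1, q.2.2⟩⟩, not_le.2 q.1.2⟩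
      left_inv := fun _ => rfl
      right_inv := fun _ => rfl }
  have (j : Fin m) : Finite {i : ℕ | (j : ℕ) + 1 ≤ lam i} :=
    Finite.of_injective (fun i => (⟨i.1, ⟨j, i.2⟩⟩ : Σ i, Fin (lam i)))
      fun a b hab => Subtype.ext (congrArg Sigma.fst hab)
  rw [Nat.card_congr e, Nat.card_sigma, Finset.sum_range]
  rfl

/-- The dual partition of a Jordan type records the nullities of the powers. -/
theorem finrank_range_pow_add_sum_dualPart {n : ℕ} {lam : ℕ → ℕ} {A : Matrix (Fin n) (Fin n) k}
    (E : Module.AEval' A.mulVecLin ≃ₗ[k[X]] MMod k lam) (m : ℕ) :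
    finrank k (LinearMap.range (A.mulVecLin ^ m)) +
      ∑ j ∈ Finset.range m, dualPart lam (j + 1) = n := by
  classical
  obtain ⟨hfin, hcard, hrank⟩ := rank_pow_eq_card E m
  rw [hrank, ← card_sigma_fin_lt, ← Nat.card_sum, Nat.card_congr (Equiv.sumCompl _), hcard]

end

/-- Kraft's degeneration criterion: `B` lies in the Zariski closure of the
`GL_n(k)`-conjugation orbit of `A` (every polynomial in the matrix entries
vanishing on the orbit of `A` vanishes at `B`) if and only if the partial sums
of the dual partitions satisfy `λ̄₁ + ⋯ + λ̄ₘ ≤ ν̄₁ + ⋯ + ν̄ₘ` for all `m ≥ 1`.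
Here `A`, `B` are nilpotent of Jordan types `λ`, `ν` respectively, meaning the
`k[T]`-module structure on `kⁿ` where `T` acts as `A` (resp. `B`) is isomorphic
to `M(λ,k)` (resp. `M(ν,k)`), and `|λ| = |ν| = n`. -/
theorem mem_orbit_closure_iff_dual_partial_sums (k : Type) [Field k] [IsAlgClosed k]
    (n : ℕ) (lam nu : PartitionSeq)
    (hlam : ∑ᶠ i, lam.parts i = n) (hnu : ∑ᶠ i, nu.parts i = n)
    (A B : Matrix (Fin n) (Fin n) k)
    (hA : IsNilpotent A) (hB : IsNilpotent B)
    (hAtype : Nonempty ((Module.AEval' A.mulVecLin) ≃ₗ[Polynomial k] MMod k lam.parts))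
    (hBtype : Nonempty ((Module.AEval' B.mulVecLin) ≃ₗ[Polynomial k] MMod k nu.parts)) :
    (∀ P : MvPolynomial (Fin n × Fin n) k,
        (∀ g : GL (Fin n) k,
          MvPolynomial.eval
            (fun p => ((g : Matrix (Fin n) (Fin n) k) * A *
              ((g⁻¹ : GL (Fin n) k) : Matrix (Fin n) (Fin n) k)) p.1 p.2) P = 0) →
        MvPolynomial.eval (fun p => B p.1 p.2) P = 0)
      ↔ (∀ m : ℕ, 1 ≤ m →
          ∑ i ∈ Finset.range m, dualPart lam.parts (i + 1)
            ≤ ∑ i ∈ Finset.range m, dualPart nu.parts (i + 1)) := by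
  have hA' := finrank_range_pow_add_sum_dualPart hAtype.some
  have hB' := finrank_range_pow_add_sum_dualPart hBtype.some
  constructor
  · intro h m _
    have hr := rank_pow_le_of_mem_orbit_closure h m
    rw [rank_pow_eq_finrank, rank_pow_eq_finrank] at hr
    have := hA' m
    have := hB' m
    omega
  · intro h P hP
    refine mem_orbit_closure_of_rank_pow_le hA (fun m => ?_) P hP
    rcases Nat.eq_zero_or_pos m with rfl | hm
    · simp
    · rw [rank_pow_eq_finrank, rank_pow_eq_finrank]
      have := h m hm
      have := hA' m
      have := hB' m
      omega
end
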